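/- arXiv:2102.13590 — 6 statements merged into one kernel-verified Lean document; each statement's English description precedes it below -/
import Mathlib

section
/- Let ϱ ≥ 0, h > 0, λ ∈ ℝ, and let β ≥ β₀ where β₀ := (ϱ + h)/3. Then for every real ξ ≠ 0 one has λ + β·ξ² − ϱ·ξ·coth ξ − ξ·coth(h·ξ) > λ − λ₀, where λ₀ := ϱ + 1/h; moreover λ − λ₀ is the greatest lower bound (infimum) of the set {λ + β·ξ² − ϱ·ξ·coth ξ − ξ·coth(h·ξ) : ξ ∈ ℝ, ξ ≠ 0}. (This identifies the bottom of the continuous spectrum of the linearized augmented potential in the strong surface tension regime β ≥ β₀.) -/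
/-- Helper: the hyperbolic cotangent. -/
noncomputable def coth (x : ℝ) : ℝ := Real.cosh x / Real.sinh x

theorem aux_g {x : ℝ} (hx : 0 < x) : Real.sinh x < x * Real.cosh x := by
  have hd : ∀ y : ℝ, HasDerivAt (fun x => x * Real.cosh x - Real.sinh x) (y * Real.sinh y) y := by
    intro y
    have := ((hasDerivAt_id y).mul (Real.hasDerivAt_cosh y)).sub (Real.hasDerivAt_sinh y)
    refine this.congr_deriv ?_
    simp
  have hm : StrictMonoOn (fun x => x * Real.cosh x - Real.sinh x) (Set.Ici 0) := by
    apply strictMonoOn_of_deriv_pos (convex_Ici 0)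
    · exact fun y _ => (hd y).continuousAt.continuousWithinAt
    · intro y hy
      rw [interior_Ici] at hy
      rw [(hd y).deriv]
      exact mul_pos hy (Real.sinh_pos_iff.2 hy)
  have := hm (Set.mem_Ici.2 le_rfl) (Set.mem_Ici.2 hx.le) hx
  simp at this
  linarith

theorem aux_f {x : ℝ} (hx : 0 < x) : x * Real.cosh x < (1 + x ^ 2 / 3) * Real.sinh x := by
  have hd : ∀ y : ℝ, HasDerivAt (fun x => (1 + x ^ 2 / 3) * Real.sinh x - x * Real.cosh x)
      (y / 3 * (y * Real.cosh y - Real.sinh y)) y := by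
    intro y
    have := (((((hasDerivAt_id y).pow 2).div_const 3).const_add 1).mul
      (Real.hasDerivAt_sinh y)).sub ((hasDerivAt_id y).mul (Real.hasDerivAt_cosh y))
    refine this.congr_deriv ?_
    simp
    ring
  have hm : StrictMonoOn (fun x => (1 + x ^ 2 / 3) * Real.sinh x - x * Real.cosh x)
      (Set.Ici 0) := by
    apply strictMonoOn_of_deriv_pos (convex_Ici 0)
    · exact fun y _ => (hd y).continuousAt.continuousWithinAt
    · intro y hy
      rw [interior_Ici] at hy
      have hy' : 0 < y := hy
      rw [(hd y).deriv]
      exact mul_pos (by positivity) (sub_pos.2 (aux_g hy'))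
  have := hm (Set.mem_Ici.2 le_rfl) (Set.mem_Ici.2 hx.le) hx
  simp at this
  linarith

theorem aux_pos {x : ℝ} (hx : 0 < x) : 1 < x * coth x ∧ x * coth x < 1 + x ^ 2 / 3 := by
  have hs := Real.sinh_pos_iff.2 hx
  unfold coth
  rw [← mul_div_assoc, lt_div_iff₀ hs, div_lt_iff₀ hs, one_mul]
  exact ⟨aux_g hx, aux_f hx⟩

theorem aux {x : ℝ} (hx : x ≠ 0) : 1 < x * coth x ∧ x * coth x < 1 + x ^ 2 / 3 := by
  rcases lt_or_gt_of_ne hx with h | h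
  · have := aux_pos (neg_pos.2 h)
    have e : -x * coth (-x) = x * coth x := by
      simp [coth, div_neg]
    rwa [e, neg_sq] at this
  · exact aux_pos h

theorem aux_h {h x : ℝ} (hh : 0 < h) (hx : x ≠ 0) :
    1 / h < x * coth (h * x) ∧ x * coth (h * x) < 1 / h + h * x ^ 2 / 3 := by
  obtain ⟨h1, h2⟩ := aux (mul_ne_zero hh.ne' hx)
  constructor
  · rw [div_lt_iff₀ hh]
    linarith
  · have e : 1 / h + h * x ^ 2 / 3 = (1 + (h * x) ^ 2 / 3) / h := by
      field_simp
    rw [e, lt_div_iff₀ hh]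
    linarith

/-- For `ϱ ≥ 0`, `h > 0`, any `lam ∈ ℝ`, and `β ≥ β₀ := (ϱ + h)/3`,
the dispersion quantity `lam + β ξ² − ϱ ξ coth ξ − ξ coth (h ξ)` is strictly greater
than `lam − λ₀` (with `λ₀ := ϱ + 1/h`) for every `ξ ≠ 0`, and `lam − λ₀` is the
infimum of these values. -/
theorem stmt0 (ϱ h lam β : ℝ) (hϱ : 0 ≤ ϱ) (hh : 0 < h)
    (hβ : (ϱ + h) / 3 ≤ β) :
    (∀ ξ : ℝ, ξ ≠ 0 →
      lam - (ϱ + 1 / h) <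
        lam + β * ξ ^ 2 - ϱ * ξ * coth ξ - ξ * coth (h * ξ)) ∧
    IsGLB {y : ℝ | ∃ ξ : ℝ, ξ ≠ 0 ∧
        y = lam + β * ξ ^ 2 - ϱ * ξ * coth ξ - ξ * coth (h * ξ)}
      (lam - (ϱ + 1 / h)) := by
  have key : ∀ ξ : ℝ, ξ ≠ 0 →
      lam - (ϱ + 1 / h) <
        lam + β * ξ ^ 2 - ϱ * ξ * coth ξ - ξ * coth (h * ξ) := by
    intro ξ hξ
    have h1 := mul_le_mul_of_nonneg_left (aux hξ).2.le hϱ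
    have h2 := (aux_h hh hξ).2
    have h3 := mul_le_mul_of_nonneg_right hβ (sq_nonneg ξ)
    linarith
  refine ⟨key, ?_, ?_⟩
  · rintro y ⟨ξ, hξ, rfl⟩
    exact (key ξ hξ).le
  · intro b hb
    have hβ0 : 0 < β := lt_of_lt_of_le (by positivity) hβ
    refine le_of_forall_pos_le_add fun ε hε => ?_
    have hp : 0 < ε / β := by positivity
    have hξ : √(ε / β) ≠ 0 := (Real.sqrt_pos.2 hp).ne'
    have h0 := hb ⟨√(ε / β), hξ, rfl⟩
    have h1 := mul_le_mul_of_nonneg_left (aux hξ).1.le hϱ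
    have h2 := (aux_h hh hξ).1
    have h3 : β * √(ε / β) ^ 2 = ε := by
      rw [Real.sq_sqrt hp.le]
      field_simp
    linarith
end

section
/- Let ϱ ≥ 0 and h > 0, and set λ₀ := ϱ + 1/h and β₀ := (ϱ + h)/3. Then the remainder 𝔯(ξ) := β₀·ξ² + λ₀ − ϱ·ξ·coth ξ − ξ·coth(h·ξ), defined for ξ ≠ 0, satisfies 𝔯(ξ)/ξ⁴ → (ϱ + h³)/45 as ξ → 0 (limit along the punctured neighborhood of 0); i.e., 𝔯(ξ) = γ·ξ⁴ + o(ξ⁴) with γ = (ϱ + h³)/45. (This is the fourth-order expansion of the dispersion symbol at the critical point (β₀, λ₀), giving the coefficient γ of the limiting Kawahara operator.) -/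
open Filter

noncomputable def remE (x : ℝ) : ℝ := Real.exp x - (1 + x + x^2/2 + x^3/6 + x^4/24 + x^5/120)

theorem remE_tendsto : Tendsto (fun x : ℝ => remE x / x ^ 5)
    (nhdsWithin (0 : ℝ) {(0 : ℝ)}ᶜ) (nhds 0) := by
  have h := (Real.exp_sub_sum_range_succ_isLittleO_pow 5).tendsto_div_nhds_zero
  refine (h.mono_left nhdsWithin_le_nhds).congr ?_
  intro x
  simp [remE, Finset.sum_range_succ, Nat.factorial]

theorem neg_tendsto_punct (c : ℝ) (hc : c ≠ 0) : Tendsto (fun x : ℝ => c * x)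
    (nhdsWithin (0 : ℝ) {(0 : ℝ)}ᶜ) (nhdsWithin (0 : ℝ) {(0 : ℝ)}ᶜ) := by
  refine tendsto_nhdsWithin_iff.2 ⟨?_, ?_⟩
  · have : Tendsto (fun x : ℝ => c * x) (nhds 0) (nhds (c * 0)) :=
      (continuous_const.mul continuous_id).tendsto 0
    rw [mul_zero] at this
    exact this.mono_left nhdsWithin_le_nhds
  · filter_upwards [self_mem_nhdsWithin] with x hx
    exact mul_ne_zero hc hx

theorem coth_tendsto : Tendsto (fun x : ℝ => (x ^ 2 / 3 + 1 - x * coth x) / x ^ 4)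
    (nhdsWithin (0 : ℝ) {(0 : ℝ)}ᶜ) (nhds (1 / 45)) := by
  have h1 := remE_tendsto
  have h2 := h1.comp (neg_tendsto_punct (-1) (by norm_num))
  have hx : Tendsto (fun x : ℝ => x) (nhdsWithin (0 : ℝ) {(0 : ℝ)}ᶜ) (nhds 0) :=
    tendsto_id.mono_left nhdsWithin_le_nhds
  have hs : Tendsto (fun x : ℝ => Real.sinh x / x) (nhdsWithin (0 : ℝ) {(0 : ℝ)}ᶜ) (nhds 1) := by
    have := (Real.hasDerivAt_sinh 0).tendsto_slope
    rw [Real.cosh_zero] at this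
    refine this.congr ?_
    intro x
    simp [slope_def_field]
  have key := (((((hx.pow 2).div_const 360).const_add (1/45)).add
    ((((hx.pow 2).div_const 3).add_const 1).mul ((h1.add h2).div_const 2))).sub
    (hx.mul ((h1.sub h2).div_const 2))).div hs one_ne_zero
  norm_num at key
  norm_num
  refine key.congr' ?_
  filter_upwards [self_mem_nhdsWithin] with x hx
  have hx0 : x ≠ 0 := hx
  have hs0 : Real.sinh x ≠ 0 := by rwa [Ne, Real.sinh_eq_zero]
  have e1 : Real.exp x = Real.cosh x + Real.sinh x := (Real.cosh_add_sinh x).symm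
  have e2 : Real.exp (-x) = Real.cosh x - Real.sinh x := (Real.cosh_sub_sinh x).symm
  simp only [Function.comp, remE, coth, neg_one_mul, e1, e2, Pi.div_apply]
  field_simp
  ring

/-- For `ϱ ≥ 0`, `h > 0`, with `λ₀ := ϱ + 1/h` and
`β₀ := (ϱ + h)/3`, the remainder `𝔯(ξ) := β₀ ξ² + λ₀ − ϱ ξ coth ξ − ξ coth (h ξ)`
satisfies `𝔯(ξ)/ξ⁴ → (ϱ + h³)/45` as `ξ → 0` along `ξ ≠ 0`. -/
theorem stmt4 (ϱ h : ℝ) (hϱ : 0 ≤ ϱ) (hh : 0 < h) :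
    Tendsto
      (fun ξ : ℝ =>
        ((ϱ + h) / 3 * ξ ^ 2 + (ϱ + 1 / h) - ϱ * ξ * coth ξ - ξ * coth (h * ξ)) / ξ ^ 4)
      (nhdsWithin (0 : ℝ) {(0 : ℝ)}ᶜ) (nhds ((ϱ + h ^ 3) / 45)) := by
  have h1 := coth_tendsto
  have h2 := h1.comp (neg_tendsto_punct h hh.ne')
  have key := (h1.const_mul ϱ).add (h2.const_mul (h ^ 3))
  have e : ϱ * (1 / 45) + h ^ 3 * (1 / 45) = (ϱ + h ^ 3) / 45 := by ring
  rw [e] at key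
  refine key.congr' ?_
  filter_upwards [self_mem_nhdsWithin] with x hx
  have hx0 : x ≠ 0 := hx
  have hh0 := hh.ne'
  simp only [Function.comp]
  generalize coth x = a
  generalize coth (h * x) = b
  field_simp
  ring
end

section
/- Let ϱ ≥ 0, h > 0, δ ∈ ℝ, set λ₀ := ϱ + 1/h, β₀ := (ϱ + h)/3 and γ := (ϱ + h³)/45, and fix ξ ≠ 0. Then, as ε → 0⁺, ε⁻⁴·[ (β₀ + 2(1+δ)·γ·ε²)·ε²·ξ² + λ₀ + γ·ε⁴ − ϱ·(εξ)·coth(εξ) − (εξ)·coth(h·εξ) ] → γ·(ξ⁴ + 2(1+δ)·ξ² + 1). (This is the pointwise convergence of the rescaled Fourier symbol of the linearized augmented potential, along the near-critical parameter curve β = β₀ + 2(1+δ)γε², λ = λ₀ + γε⁴ of Region C, to the symbol of the linearized steady Kawahara operator γ(∂ₓ⁴ − 2(1+δ)∂ₓ² + 1).) -/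
open Filter

lemma aux_exp {x : ℝ} (hx : |x| ≤ 1) :
    |Real.exp x - (1 + x + x^2/2 + x^3/6 + x^4/24 + x^5/120)| ≤ |x|^6 := by
  have h := Real.exp_bound hx (n := 6) (by norm_num)
  simp only [Finset.sum_range_succ, Finset.sum_range_zero, Nat.factorial] at h
  norm_num at h
  have h6 : 0 ≤ |x|^6 := by positivity
  have e : (1 + x + x^2/2 + x^3/6 + x^4/24 + x^5/120) =
    (1 + x + x ^ 2 / 2 + x ^ 3 / 6 + x ^ 4 / 24 + x ^ 5 / 120) := by ring
  rw [e]
  refine h.trans ?_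
  nlinarith

lemma aux_num {x : ℝ} (hx : |x| ≤ 1) :
    |(1 + x^2/3) * Real.sinh x - x * Real.cosh x - x^5/45| ≤ 4 * |x|^6 := by
  have h1 := aux_exp hx
  have h2 := aux_exp (x := -x) (by simpa using hx)
  rw [abs_neg] at h2
  set r := Real.exp x - (1 + x + x^2/2 + x^3/6 + x^4/24 + x^5/120) with hr
  set s := Real.exp (-x) - (1 + (-x) + (-x)^2/2 + (-x)^3/6 + (-x)^4/24 + (-x)^5/120) with hs
  have e : (1 + x^2/3) * Real.sinh x - x * Real.cosh x - x^5/45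
      = x^7/360 + (1 + x^2/3 - x)/2 * r + (-(1 + x^2/3 + x)/2) * s := by
    rw [Real.sinh_eq, Real.cosh_eq, hr, hs]; ring
  have hx' := abs_le.1 hx
  have h6 : 0 ≤ |x|^6 := by positivity
  have a1 : |x^7/360| ≤ |x|^6 := by
    rw [abs_div, abs_pow, pow_succ]
    norm_num
    nlinarith [abs_nonneg x]
  have a2 : |(1 + x^2/3 - x)/2| ≤ 3/2 := by rw [abs_le]; constructor <;> nlinarith
  have a3 : |-(1 + x^2/3 + x)/2| ≤ 3/2 := by rw [abs_le]; constructor <;> nlinarith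
  have b2 : |(1 + x^2/3 - x)/2 * r| ≤ 3/2 * |x|^6 := by
    rw [abs_mul]; exact mul_le_mul a2 h1 (abs_nonneg _) (by norm_num)
  have b3 : |-(1 + x^2/3 + x)/2 * s| ≤ 3/2 * |x|^6 := by
    rw [abs_mul]; exact mul_le_mul a3 h2 (abs_nonneg _) (by norm_num)
  rw [e]
  refine (abs_add_le _ _).trans ?_
  have := abs_add_le (x^7/360) ((1 + x^2/3 - x)/2 * r)
  linarith

lemma aux_lim : Tendsto (fun x : ℝ => (1 + x^2/3 - x * coth x) / x^4)
    (nhdsWithin 0 {0}ᶜ) (nhds (1/45)) := by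
  have hs : Tendsto (fun x : ℝ => Real.sinh x / x) (nhdsWithin 0 {0}ᶜ) (nhds 1) := by
    have h := (hasDerivAt_iff_tendsto_slope.1 (Real.hasDerivAt_sinh 0))
    rw [Real.cosh_zero] at h
    refine h.congr fun x => ?_
    simp [slope_def_field]
  have hn : Tendsto (fun x : ℝ => ((1 + x^2/3) * Real.sinh x - x * Real.cosh x) / x^5)
      (nhdsWithin 0 {0}ᶜ) (nhds (1/45)) := by
    rw [tendsto_iff_norm_sub_tendsto_zero]
    have h0 : Tendsto (fun x : ℝ => 4 * |x|) (nhdsWithin 0 {0}ᶜ) (nhds 0) := by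
      have : Continuous (fun x : ℝ => 4 * |x|) := by fun_prop
      have := this.tendsto 0
      simp only [abs_zero, mul_zero] at this
      exact this.mono_left nhdsWithin_le_nhds
    refine squeeze_zero' (Eventually.of_forall fun x => norm_nonneg _) ?_ h0
    have hb : ∀ᶠ x : ℝ in nhdsWithin 0 {0}ᶜ, |x| ≤ 1 := by
      refine nhdsWithin_le_nhds ?_
      filter_upwards [Metric.ball_mem_nhds (0:ℝ) one_pos] with x hx
      simpa using (le_of_lt (by simpa using hx : |x| < 1))
    filter_upwards [hb, self_mem_nhdsWithin] with x hx hx0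
    have hx0 : x ≠ 0 := hx0
    have e : ((1 + x^2/3) * Real.sinh x - x * Real.cosh x) / x^5 - 1/45
      = ((1 + x^2/3) * Real.sinh x - x * Real.cosh x - x^5/45) / x^5 := by
      field_simp
    rw [e, Real.norm_eq_abs, abs_div, abs_pow, div_le_iff₀ (by positivity)]
    refine (aux_num hx).trans (le_of_eq (by ring))
  have h := hn.div hs one_ne_zero
  rw [div_one] at h
  refine h.congr' ?_
  filter_upwards [self_mem_nhdsWithin] with x hx0
  have hx0 : x ≠ 0 := hx0
  have : Real.sinh x ≠ 0 := by simpa using hx0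
  simp only [Pi.div_apply, coth]
  field_simp

/-- For `ϱ ≥ 0`, `h > 0`, `δ ∈ ℝ`, with `λ₀ := ϱ + 1/h`,
`β₀ := (ϱ + h)/3`, `γ := (ϱ + h³)/45`, and fixed `ξ ≠ 0`, as `ε → 0⁺`,
`ε⁻⁴ [(β₀ + 2(1+δ)γε²) ε² ξ² + λ₀ + γ ε⁴ − ϱ (εξ) coth (εξ) − (εξ) coth (h εξ)]`
converges to `γ (ξ⁴ + 2(1+δ) ξ² + 1)`. -/
theorem stmt6 (ϱ h δ ξ : ℝ) (hϱ : 0 ≤ ϱ) (hh : 0 < h) (hξ : ξ ≠ 0) :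
    Tendsto
      (fun ε : ℝ =>
        ε⁻¹ ^ 4 *
          (((ϱ + h) / 3 + 2 * (1 + δ) * ((ϱ + h ^ 3) / 45) * ε ^ 2) * ε ^ 2 * ξ ^ 2
            + (ϱ + 1 / h) + ((ϱ + h ^ 3) / 45) * ε ^ 4
            - ϱ * (ε * ξ) * coth (ε * ξ) - (ε * ξ) * coth (h * (ε * ξ))))
      (nhdsWithin (0 : ℝ) (Set.Ioi 0))
      (nhds (((ϱ + h ^ 3) / 45) * (ξ ^ 4 + 2 * (1 + δ) * ξ ^ 2 + 1))) := by
  have key : ∀ c : ℝ, c ≠ 0 → Tendsto (fun ε : ℝ =>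
      (1 + (c * ε)^2/3 - (c * ε) * coth (c * ε)) / (c * ε)^4)
      (nhdsWithin (0 : ℝ) (Set.Ioi 0)) (nhds (1/45)) := by
    intro c hc
    refine aux_lim.comp (tendsto_nhdsWithin_iff.2 ⟨?_, ?_⟩)
    · have : Continuous (fun ε : ℝ => c * ε) := by fun_prop
      have := this.tendsto 0
      rw [mul_zero] at this
      exact this.mono_left nhdsWithin_le_nhds
    · filter_upwards [self_mem_nhdsWithin] with x hx
      exact mul_ne_zero hc (ne_of_gt hx)
  have h1 := (key ξ hξ).const_mul (ϱ * ξ^4)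
  have h2 := (key (h * ξ) (mul_ne_zero hh.ne' hξ)).const_mul (h^3 * ξ^4)
  have h3 := (h1.add h2).add_const
    (2 * (1 + δ) * ((ϱ + h ^ 3) / 45) * ξ^2 + (ϱ + h ^ 3) / 45)
  refine Tendsto.congr' ?_ (h3.trans (le_of_eq ?_))
  · filter_upwards [self_mem_nhdsWithin] with ε hε
    have hε : ε ≠ 0 := ne_of_gt hε
    have hh' := hh.ne'
    rw [show h * (ε * ξ) = h * ξ * ε by ring, mul_comm ε ξ]
    generalize coth (ξ * ε) = A
    generalize coth (h * ξ * ε) = B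
    field_simp
    ring
  · congr 1
    ring
end

section
/- Let b > 0 and κ ∈ ℝ, and set M := √(κ² + 4b). Then κ + M·cosh x > 0 for every x ∈ ℝ, and the function v : ℝ → ℝ defined by v(x) := 2/(κ + M·cosh x) satisfies the steady Gardner equation v''(x) = v(x) − (3/2)·κ·v(x)² − 2·b·v(x)³ for every x ∈ ℝ. (With b = ϱ + 1/h³, v is the normalized leading-order free surface profile of the Gardner-type solitary internal waves of Region A in the resonant regime ϱ − 1/h² = O(ε).) -/
/-- For `b > 0`, `κ ∈ ℝ`, `M := √(κ² + 4b)`, one has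
`κ + M cosh x > 0` for all `x`, and `v(x) := 2/(κ + M cosh x)` solves the
steady Gardner equation `v'' = v − (3/2) κ v² − 2 b v³` on `ℝ`. -/
theorem stmt8 (b κ : ℝ) (hb : 0 < b)
    (v : ℝ → ℝ)
    (hv : ∀ x : ℝ, v x = 2 / (κ + Real.sqrt (κ ^ 2 + 4 * b) * Real.cosh x)) :
    (∀ x : ℝ, 0 < κ + Real.sqrt (κ ^ 2 + 4 * b) * Real.cosh x) ∧
    (∀ x : ℝ, deriv (deriv v) x = v x - 3 / 2 * κ * v x ^ 2 - 2 * b * v x ^ 3) := by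
  have hM2 : Real.sqrt (κ ^ 2 + 4 * b) ^ 2 = κ ^ 2 + 4 * b := Real.sq_sqrt (by positivity)
  have hMk : |κ| < Real.sqrt (κ ^ 2 + 4 * b) := by
    apply Real.lt_sqrt_of_sq_lt
    rw [sq_abs]; linarith
  generalize Real.sqrt (κ ^ 2 + 4 * b) = M at *
  have hM : 0 < M := lt_of_le_of_lt (abs_nonneg _) hMk
  have hpos : ∀ x : ℝ, 0 < κ + M * Real.cosh x := by
    intro x
    have h1 := Real.one_le_cosh x
    have h2 := neg_abs_le κ
    nlinarith
  refine ⟨hpos, ?_⟩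
  have hD : ∀ x : ℝ, HasDerivAt (fun y => κ + M * Real.cosh y) (M * Real.sinh x) x := fun x =>
    ((Real.hasDerivAt_cosh x).const_mul M).const_add κ
  have hv' : v = fun x => 2 / (κ + M * Real.cosh x) := funext hv
  have hd : deriv v = fun x => (-2 * (M * Real.sinh x)) / (κ + M * Real.cosh x) ^ 2 := by
    funext x
    rw [hv']
    have h := (hasDerivAt_const x (2 : ℝ)).fun_div (hD x) (hpos x).ne'
    rw [h.deriv]
    congr 1
    ring
  intro x
  have h := (((Real.hasDerivAt_sinh x).const_mul M).const_mul (-2)).fun_div ((hD x).fun_pow 2)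
    (pow_ne_zero 2 (hpos x).ne')
  rw [hd, h.deriv, hv x]
  have hne := (hpos x).ne'
  have hs := Real.sinh_sq x
  have hb' : b = (M ^ 2 - κ ^ 2) / 4 := by linarith
  subst hb'
  generalize Real.sinh x = s at *
  generalize Real.cosh x = c at *
  field_simp
  push_cast
  ring_nf
  simp only [hs]
  ring
end

section
/- The function Z : ℝ → ℝ defined by Z(x) := (35/24)·sech( (√6/12)·x )⁴ satisfies the steady Kawahara equation Z''''(x) − (13/6)·Z''(x) + Z(x) − Z(x)² = 0 for every x ∈ ℝ; that is, Z is an explicit, even, positive, exponentially localized homoclinic solution of Z'''' − 2(1+δ)Z'' + Z − Z² = 0 for the parameter value 2(1+δ) = 13/6. -/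
lemma aux_S (k x : ℝ) : HasDerivAt (fun x => 1 / Real.cosh (k * x))
    (-k * (1 / Real.cosh (k * x)) * Real.tanh (k * x)) x := by
  have hc := (Real.cosh_pos (k * x)).ne'
  have h1 : HasDerivAt (fun x : ℝ => k * x) k x := by
    simpa using (hasDerivAt_id x).const_mul k
  have h := (h1.cosh).inv hc
  simp only [one_div]
  refine HasDerivAt.congr_deriv h ?_
  rw [Real.tanh_eq_sinh_div_cosh]
  field_simp

lemma aux_T (k x : ℝ) : HasDerivAt (fun x => Real.tanh (k * x))
    (k * (1 / Real.cosh (k * x)) ^ 2) x := by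
  have hc := (Real.cosh_pos (k * x)).ne'
  have h1 : HasDerivAt (fun x : ℝ => k * x) k x := by
    simpa using (hasDerivAt_id x).const_mul k
  have h := (h1.sinh).div (h1.cosh) hc
  have e : (fun x => Real.tanh (k * x)) = (fun x => Real.sinh (k * x)) / fun x => Real.cosh (k * x) := by
    funext y
    simp [Real.tanh_eq_sinh_div_cosh]
  rw [e]
  refine HasDerivAt.congr_deriv h ?_
  field_simp
  linear_combination k * Real.cosh_sq (k * x)

lemma aux_id (y : ℝ) : Real.tanh y ^ 2 = 1 - (1 / Real.cosh y) ^ 2 := by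
  have hc := (Real.cosh_pos y).ne'
  rw [Real.tanh_eq_sinh_div_cosh]
  field_simp
  linear_combination -Real.cosh_sq y

lemma aux_even (k a b x : ℝ) :
    HasDerivAt (fun x => a * (1 / Real.cosh (k * x)) ^ 4 + b * (1 / Real.cosh (k * x)) ^ 6)
    ((-4 * k * a) * ((1 / Real.cosh (k * x)) ^ 4 * Real.tanh (k * x))
      + (-6 * k * b) * ((1 / Real.cosh (k * x)) ^ 6 * Real.tanh (k * x))) x := by
  have h := (((aux_S k x).fun_pow 4).const_mul a).fun_add (((aux_S k x).fun_pow 6).const_mul b)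
  refine HasDerivAt.congr_deriv h ?_
  push_cast
  ring

lemma aux_odd (k a b x : ℝ) :
    HasDerivAt (fun x => a * ((1 / Real.cosh (k * x)) ^ 4 * Real.tanh (k * x))
      + b * ((1 / Real.cosh (k * x)) ^ 6 * Real.tanh (k * x)))
    ((-4 * k * a) * (1 / Real.cosh (k * x)) ^ 4
      + (5 * k * a - 6 * k * b) * (1 / Real.cosh (k * x)) ^ 6
      + 7 * k * b * (1 / Real.cosh (k * x)) ^ 8) x := by
  have h := ((((aux_S k x).fun_pow 4).fun_mul (aux_T k x)).const_mul a).fun_add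
    ((((aux_S k x).fun_pow 6).fun_mul (aux_T k x)).const_mul b)
  refine HasDerivAt.congr_deriv h ?_
  have hi := aux_id (k * x)
  generalize 1 / Real.cosh (k * x) = s at *
  generalize Real.tanh (k * x) = t at *
  push_cast
  linear_combination (-4 * k * a * s ^ 4 - 6 * k * b * s ^ 6) * hi

/-- The function `Z(x) = (35/24) sech((√6/12) x)⁴` satisfies the
steady Kawahara equation `Z'''' − (13/6) Z'' + Z − Z² = 0` on `ℝ`, i.e. it is an
explicit homoclinic solution of `Z'''' − 2(1+δ) Z'' + Z − Z² = 0` with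
`2(1+δ) = 13/6`. -/
theorem stmt9 (Z : ℝ → ℝ)
    (hZ : ∀ x : ℝ, Z x = 35 / 24 * (1 / Real.cosh (Real.sqrt 6 / 12 * x)) ^ 4) :
    ∀ x : ℝ,
      deriv^[4] Z x - 13 / 6 * deriv^[2] Z x + Z x - Z x ^ 2 = 0 := by
  intro x
  set k : ℝ := Real.sqrt 6 / 12 with hk
  have hk2 : k ^ 2 = 1 / 24 := by
    rw [hk, div_pow, Real.sq_sqrt (by norm_num)]
    norm_num
  have e0 : Z = fun x => (35 / 24) * (1 / Real.cosh (k * x)) ^ 4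
      + 0 * (1 / Real.cosh (k * x)) ^ 6 := by
    funext y
    rw [hZ]
    ring
  have e1 := funext fun y => (aux_even k (35 / 24) 0 y).deriv
  rw [← e0] at e1
  change deriv Z = _ at e1
  have e2 : deriv (deriv Z) = fun y => (-4 * k * (-4 * k * (35 / 24))) * (1 / Real.cosh (k * y)) ^ 4
      + (5 * k * (-4 * k * (35 / 24))) * (1 / Real.cosh (k * y)) ^ 6 := by
    rw [e1]
    funext y
    rw [(aux_odd k _ _ y).deriv]
    ring
  have e3 := funext fun y => (aux_even k (-4 * k * (-4 * k * (35 / 24)))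
    (5 * k * (-4 * k * (35 / 24))) y).deriv
  rw [← e2] at e3
  change deriv (deriv (deriv Z)) = _ at e3
  have e4 := (aux_odd k (-4 * k * (-4 * k * (-4 * k * (35 / 24))))
    (-6 * k * (5 * k * (-4 * k * (35 / 24)))) x).deriv
  rw [← e3] at e4
  simp only [Function.iterate_succ, Function.iterate_zero, Function.comp_apply, id]
  rw [e4, e2, hZ x]
  simp only []
  generalize 1 / Real.cosh (k * x) = s at *
  have hk4 : k ^ 4 = 1 / 576 := by
    rw [show k ^ 4 = (k ^ 2) ^ 2 by ring, hk2]
    norm_num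
  ring_nf
  rw [hk2, hk4]
  ring
end

section
/- Let b > 0 and κ ∈ ℝ, and set M := √(κ² + 4b). Then the function x ↦ 1/(κ + M·cosh x)² is integrable on ℝ and ∫_ℝ 1/(κ + M·cosh x)² dx = 1/(2b) − (κ/(2·b^{3/2}))·arctan( (M − κ)/(2√b) ). (Up to a factor 4, this is the explicit evaluation of the squared L² norm ∫ η̃² of the Gardner soliton profile η̃ = 2/(κ + M cosh x), which gives the leading-order momentum of the Gardner-type solitary internal waves.) -/
open MeasureTheory

lemma aux_arctan (k t : ℝ) (ht : 0 < t) (h : t ^ 2 + 2 * k * t = 1) :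
    Real.pi / 2 - Real.arctan k = 2 * Real.arctan t := by
  have h0 : 0 < Real.arctan t := by simpa using Real.arctan_strictMono ht
  have h1 := Real.arctan_lt_pi_div_two t
  have h2 : Real.tan (Real.pi / 2 - 2 * Real.arctan t) = k := by
    rw [Real.tan_pi_div_two_sub, Real.tan_two_mul, Real.tan_arctan, inv_div]
    field_simp
    linarith
  have h3 := Real.arctan_tan (x := Real.pi / 2 - 2 * Real.arctan t) (by linarith) (by linarith)
  rw [h2] at h3
  linarith

lemma aux_main (b κ M s : ℝ) (hs : 0 < s) (hbs : s ^ 2 = b) (hM : 0 < M)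
    (hMM : M ^ 2 = κ ^ 2 + 4 * b) (hMk : |κ| < M) :
    Integrable (fun x : ℝ => 1 / (κ + M * Real.cosh x) ^ 2) ∧
    ∫ x : ℝ, 1 / (κ + M * Real.cosh x) ^ 2
      = 1 / (2 * b) - κ / (4 * b * s) * (Real.pi / 2 - Real.arctan (κ / (2 * s))) := by
  have hb : 0 < b := by rw [← hbs]; positivity
  have hD : ∀ x, 0 < κ + M * Real.cosh x := fun x => by
    have := Real.one_le_cosh x
    have := (abs_lt.1 hMk).1
    nlinarith
  let F : ℝ → ℝ := fun x => 1 / (4 * b) * (M * Real.sinh x / (κ + M * Real.cosh x))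
    - κ / (4 * b * s) * Real.arctan ((M * Real.exp x + κ) / (2 * s))
  have hF : ∀ x, HasDerivAt F (1 / (κ + M * Real.cosh x) ^ 2) x := by
    intro x
    have h1 := (((Real.hasDerivAt_sinh x).const_mul M).div
      (((Real.hasDerivAt_cosh x).const_mul M).const_add κ) (hD x).ne').const_mul (1 / (4 * b))
    have h2 := ((((Real.hasDerivAt_exp x).const_mul M).add_const κ).div_const
      (2 * s)).arctan.const_mul (κ / (4 * b * s))
    refine (h1.sub h2).congr_deriv ?_
    have e1 : 1 / (1 + ((M * Real.exp x + κ) / (2 * s)) ^ 2) * (M * Real.exp x / (2 * s))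
        = s / (κ + M * Real.cosh x) := by
      have hd := (hD x).ne'
      have : (2 * s) ^ 2 + (M * Real.exp x + κ) ^ 2
          = 2 * M * Real.exp x * (κ + M * Real.cosh x) := by
        rw [Real.cosh_eq]
        have : Real.exp x * Real.exp (-x) = 1 := by rw [← Real.exp_add]; simp
        linear_combination (4:ℝ) * hbs - hMM - M ^ 2 * this
      have e : 1 + ((M * Real.exp x + κ) / (2 * s)) ^ 2
          = 2 * M * Real.exp x * (κ + M * Real.cosh x) / (2 * s) ^ 2 := by
        rw [← this]; field_simp
      rw [e]
      have := (Real.exp_pos x).ne'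
      field_simp
    rw [e1]
    have hd := (hD x).ne'
    have := Real.cosh_sq x
    field_simp
    have h4 := Real.cosh_sq' x
    linear_combination M ^ 2 * h4 + hMM
  have hev : ∀ x, 1 / (κ + M * Real.cosh (-x)) ^ 2 = 1 / (κ + M * Real.cosh x) ^ 2 := by simp
  have hbot : Filter.Tendsto F Filter.atBot
      (nhds (1 / (4 * b) * (-1) - κ / (4 * b * s) * Real.arctan (κ / (2 * s)))) := by
    have hc : ContinuousAt (fun u : ℝ => 1 / (4 * b) * (M * (u ^ 2 - 1) / (M * u ^ 2 + 2 * κ * u + M))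
        - κ / (4 * b * s) * Real.arctan ((M * u + κ) / (2 * s))) 0 := by
      have : M * 0 ^ 2 + 2 * κ * 0 + M ≠ 0 := by simpa using hM.ne'
      fun_prop (disch := assumption)
    have := hc.tendsto.comp Real.tendsto_exp_atBot
    refine (this.congr fun x => ?_).trans (le_of_eq ?_)
    · simp only [F, Function.comp]
      congr 2
      have hd := (hD x)
      rw [Real.cosh_eq, Real.exp_neg] at *
      rw [Real.sinh_eq, Real.exp_neg]
      have := Real.exp_pos x
      have h3 : M * Real.exp x ^ 2 + 2 * κ * Real.exp x + M = 2 * Real.exp x *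
        (κ + M * ((Real.exp x + (Real.exp x)⁻¹) / 2)) := by field_simp; ring
      rw [h3]
      have := hd.ne'
      rw [div_eq_div_iff (by positivity) this]
      field_simp
    · congr 1
      field_simp
      simp
      field_simp
  have htop : Filter.Tendsto F Filter.atTop
      (nhds (1 / (4 * b) * 1 - κ / (4 * b * s) * (Real.pi / 2))) := by
    have hc : ContinuousAt (fun u : ℝ => (M * (1 - u ^ 2) / (M * u ^ 2 + 2 * κ * u + M))) 0 := by
      have : M * 0 ^ 2 + 2 * κ * 0 + M ≠ 0 := by simpa using hM.ne'
      fun_prop (disch := assumption)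
    have h1 := hc.tendsto.comp Real.tendsto_exp_neg_atTop_nhds_zero
    have e0 : (M * (1 - (0:ℝ) ^ 2) / (M * 0 ^ 2 + 2 * κ * 0 + M)) = 1 := by simp [hM.ne']
    rw [e0] at h1
    refine Filter.Tendsto.sub (Filter.Tendsto.const_mul _ (h1.congr fun x => ?_))
      (Filter.Tendsto.const_mul _ ?_)
    · simp only [Function.comp]
      have hd := (hD x)
      rw [Real.cosh_eq, Real.exp_neg] at *
      rw [Real.sinh_eq, Real.exp_neg]
      have := Real.exp_pos x
      have h3 : M * (Real.exp x)⁻¹ ^ 2 + 2 * κ * (Real.exp x)⁻¹ + M = 2 * (Real.exp x)⁻¹ *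
        (κ + M * ((Real.exp x + (Real.exp x)⁻¹) / 2)) := by field_simp; ring
      rw [h3]
      have := hd.ne'
      rw [div_eq_div_iff (by positivity) this]
      field_simp
    · refine (Real.tendsto_arctan_atTop.mono_right nhdsWithin_le_nhds).comp ?_
      exact (Filter.tendsto_atTop_add_const_right _ _
        (Real.tendsto_exp_atTop.const_mul_atTop hM)).atTop_div_const (by positivity)
  have hIoi : IntegrableOn (fun x : ℝ => 1 / (κ + M * Real.cosh x) ^ 2) (Set.Ioi 0) :=
    integrableOn_Ioi_deriv_of_nonneg' (fun x _ => hF x) (fun x _ => by positivity) htop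
  have hint : Integrable (fun x : ℝ => 1 / (κ + M * Real.cosh x) ^ 2) := by
    rw [← integrableOn_univ, ← Set.Iic_union_Ioi (a := (0:ℝ))]
    refine IntegrableOn.union ?_ hIoi
    have := Iff.mpr integrableOn_Ici_iff_integrableOn_Ioi hIoi
    have h5 := (Measure.measurePreserving_neg (volume : Measure ℝ)).integrableOn_comp_preimage
      (Homeomorph.neg ℝ).measurableEmbedding (f := fun x : ℝ => 1 / (κ + M * Real.cosh x) ^ 2)
      (s := Set.Ici 0)
    have h6 := h5.2 this
    simpa [Function.comp_def] using h6
  refine ⟨hint, ?_⟩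
  rw [integral_of_hasDerivAt_of_tendsto hF hint hbot htop]
  field_simp
  ring

/-- For `b > 0`, `κ ∈ ℝ`, `M := √(κ² + 4b)`, the function
`x ↦ 1/(κ + M cosh x)²` is integrable on `ℝ` and
`∫ 1/(κ + M cosh x)² dx = 1/(2b) − (κ/(2 b^{3/2})) arctan((M − κ)/(2√b))`. -/
theorem stmt14 (b κ : ℝ) (hb : 0 < b) :
    Integrable (fun x : ℝ => 1 / (κ + Real.sqrt (κ ^ 2 + 4 * b) * Real.cosh x) ^ 2) ∧
    ∫ x : ℝ, 1 / (κ + Real.sqrt (κ ^ 2 + 4 * b) * Real.cosh x) ^ 2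
      = 1 / (2 * b) - κ / (2 * b ^ ((3 : ℝ) / 2)) *
          Real.arctan ((Real.sqrt (κ ^ 2 + 4 * b) - κ) / (2 * Real.sqrt b)) := by
  have hs : 0 < Real.sqrt b := Real.sqrt_pos.2 hb
  have hbs : Real.sqrt b ^ 2 = b := Real.sq_sqrt hb.le
  have hMM : Real.sqrt (κ ^ 2 + 4 * b) ^ 2 = κ ^ 2 + 4 * b := Real.sq_sqrt (by positivity)
  have hM : 0 < Real.sqrt (κ ^ 2 + 4 * b) := Real.sqrt_pos.2 (by positivity)
  have hMk : |κ| < Real.sqrt (κ ^ 2 + 4 * b) := by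
    apply Real.lt_sqrt_of_sq_lt
    rw [sq_abs]; linarith
  have hp : b ^ ((3 : ℝ) / 2) = b * Real.sqrt b := by
    rw [Real.sqrt_eq_rpow, show (3:ℝ) / 2 = 1 + 1 / 2 by norm_num, Real.rpow_add hb, Real.rpow_one]
  rw [hp]
  generalize Real.sqrt (κ ^ 2 + 4 * b) = M at *
  generalize Real.sqrt b = s at *
  obtain ⟨h1, h2⟩ := aux_main b κ M s hs hbs hM hMM hMk
  refine ⟨h1, ?_⟩
  have hlt := (abs_lt.1 hMk).2
  rw [h2, aux_arctan (κ / (2 * s)) ((M - κ) / (2 * s)) (div_pos (by linarith) (by positivity))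
    (by field_simp; linear_combination hMM - 4 * hbs)]
  field_simp
  ring
end
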